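/- Assume the Seifert data and let θ be any real number with 0 < θ < 1. Then, in the parallelogram Π(a,b,c,d) with (a,b) = (a₁n + m₁, m₂) and (c,d) = (m₁, a₂n + m₂), one has M_θ⁺ + M_θ⁻ = n·[mθ ∈ ℤ] − (1 − m₁)·[mθ/a₁ ∈ ℤ] − (1 − m₂)·[mθ/a₂ ∈ ℤ], where [C] equals 1 if the condition C holds and 0 otherwise. (Equivalently, M_θ⁺ + M_θ⁻ equals the multiplicity of e^{2πiθ} as a root of the one-variable Alexander polynomial of the link T_{m₁,m₂}(a₁n, a₂n).) -/

import Mathlib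

open scoped Classical

/-- The open parallelogram spanned by `(a,b)` and `(c,d)`. -/
def para (a b c d : ℤ) : Set (ℝ × ℝ) :=
  {P | ∃ s t : ℝ, 0 < s ∧ s < 1 ∧ 0 < t ∧ t < 1 ∧
    P = (s * a + t * c, s * b + t * d)}

/-- The linear function with `u(a,b) = u(c,d) = 1`. -/
noncomputable def uFun (a b c d : ℤ) (P : ℝ × ℝ) : ℝ :=
  (((d : ℝ) - b) * P.1 + ((a : ℝ) - c) * P.2) / ((a : ℝ) * d - b * c)

/-- The number of lattice points in the open parallelogram on which `u` takes the value `θ`. -/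
noncomputable def Mcount (a b c d : ℤ) (θ : ℝ) : ℕ :=
  {p : ℤ × ℤ | ((p.1 : ℝ), (p.2 : ℝ)) ∈ para a b c d ∧
    uFun a b c d ((p.1 : ℝ), (p.2 : ℝ)) = θ}.ncard

theorem mem_para_iff {a b c d : ℤ} (hD : 0 < a * d - b * c) (x y : ℤ) :
    ((x : ℝ), (y : ℝ)) ∈ para a b c d ↔
      (0 < d * x - c * y ∧ d * x - c * y < a * d - b * c) ∧
        0 < a * y - b * x ∧ a * y - b * x < a * d - b * c := by
  have hD' : (0 : ℝ) < a * d - b * c := by exact_mod_cast hD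
  have key : ((x : ℝ), (y : ℝ)) ∈ para a b c d ↔
      ((0 : ℝ) < d * x - c * y ∧ (d * x - c * y : ℝ) < a * d - b * c) ∧
        (0 : ℝ) < a * y - b * x ∧ (a * y - b * x : ℝ) < a * d - b * c := by
    constructor
    · rintro ⟨s, t, hs0, hs1, ht0, ht1, h⟩
      obtain ⟨hx, hy⟩ := Prod.mk.inj h
      have e1 : (d * x - c * y : ℝ) = s * (a * d - b * c) := by rw [hx, hy]; ring
      have e2 : (a * y - b * x : ℝ) = t * (a * d - b * c) := by rw [hx, hy]; ring
      rw [e1, e2]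
      exact ⟨⟨mul_pos hs0 hD', mul_lt_of_lt_one_left hD' hs1⟩,
        mul_pos ht0 hD', mul_lt_of_lt_one_left hD' ht1⟩
    · rintro ⟨⟨hs0, hs1⟩, ht0, ht1⟩
      refine ⟨(d * x - c * y) / (a * d - b * c), (a * y - b * x) / (a * d - b * c),
        div_pos hs0 hD', (div_lt_one hD').2 hs1, div_pos ht0 hD', (div_lt_one hD').2 ht1, ?_⟩
      have hne := hD'.ne'
      refine Prod.ext ?_ ?_
      · change (x : ℝ) = _ * (a : ℝ) + _ * (c : ℝ)
        rw [div_mul_eq_mul_div, div_mul_eq_mul_div, ← add_div, eq_div_iff hne]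
        ring
      · change (y : ℝ) = _ * (b : ℝ) + _ * (d : ℝ)
        rw [div_mul_eq_mul_div, div_mul_eq_mul_div, ← add_div, eq_div_iff hne]
        ring
  rw [key]
  exact_mod_cast Iff.rfl

/-- Membership in the set counted by `Mcount`, for the parallelogram given by Seifert data. -/
theorem mem_para_and_uFun_eq_iff {a₁ a₂ n m₁ m₂ m : ℤ} (hn : 0 < n) (hm0 : 0 < m)
    (hm : m = m₁ * a₂ + m₂ * a₁ + n * (a₁ * a₂)) (θ : ℝ) (x y : ℤ) :
    (((x : ℝ), (y : ℝ)) ∈ para (a₁ * n + m₁) m₂ m₁ (a₂ * n + m₂) ∧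
      uFun (a₁ * n + m₁) m₂ m₁ (a₂ * n + m₂) ((x : ℝ), (y : ℝ)) = θ) ↔
    ((0 < (a₂ * n + m₂) * x - m₁ * y ∧ (a₂ * n + m₂) * x - m₁ * y < n * m) ∧
      0 < (a₁ * n + m₁) * y - m₂ * x ∧ (a₁ * n + m₁) * y - m₂ * x < n * m) ∧
    ((a₂ * x + a₁ * y : ℤ) : ℝ) = m * θ := by
  have hD : (a₁ * n + m₁) * (a₂ * n + m₂) - m₂ * m₁ = n * m := by rw [hm]; ring
  have hDR : ((a₁ * n + m₁ : ℤ) : ℝ) * ((a₂ * n + m₂ : ℤ) : ℝ) - m₂ * m₁ = n * m := by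
    exact_mod_cast hD
  have hnR : (0 : ℝ) < n := by exact_mod_cast hn
  have hmR : (0 : ℝ) < m := by exact_mod_cast hm0
  rw [mem_para_iff (by rw [hD]; positivity), hD]
  refine and_congr_right fun _ => ?_
  unfold uFun
  rw [hDR, div_eq_iff (by positivity)]
  push_cast
  constructor
  · intro h
    apply mul_left_cancel₀ hnR.ne'
    linear_combination h
  · intro h
    linear_combination (n : ℝ) * h

/-- A half-open interval of length `n * m` contains exactly `n` terms of an arithmetic
progression of step `m`. -/
theorem exists_Ico_progression {m n : ℤ} (hm : 0 < m) (S L : ℤ) :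
    ∃ c : ℤ, ∀ j : ℤ, j ∈ Finset.Ico c (c + n) ↔ L ≤ S + m * j ∧ S + m * j < L + n * m := by
  refine ⟨-((S - L) / m), fun j => ?_⟩
  rw [Finset.mem_Ico]
  have h1 : -((S - L) / m) ≤ j ↔ L ≤ S + m * j := by
    rw [neg_le, Int.le_ediv_iff_mul_le hm]
    constructor <;> intro h <;> linarith
  have h2 : j < -((S - L) / m) + n ↔ S + m * j < L + n * m := by
    rw [show j < -((S - L) / m) + n ↔ (S - L) / m < n - j by constructor <;> intro h <;> linarith,
      Int.ediv_lt_iff_lt_mul hm]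
    constructor <;> intro h <;> linarith
  rw [h1, h2]

theorem card_filter_progression_eq {m : ℤ} (hm : 0 < m) (S v : ℤ) (F : Finset ℤ)
    (hF : ∀ j, S + m * j = v → j ∈ F) :
    ((F.filter fun j => S + m * j = v).card : ℤ) = if ∃ j, S + m * j = v then 1 else 0 := by
  split_ifs with h
  · obtain ⟨j, hj⟩ := h
    have : (F.filter fun j => S + m * j = v) = {j} := by
      ext i
      simp only [Finset.mem_filter, Finset.mem_singleton]
      constructor
      · rintro ⟨_, hi⟩
        exact mul_left_cancel₀ hm.ne' (by linarith)
      · rintro rfl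
        exact ⟨hF _ hj, hj⟩
    simp [this]
  · push Not at h
    simp [h]

/-- Counting the terms of an arithmetic progression of step `m` in an open interval of length
`n * m` around `0`, with `0` itself removed. -/
theorem card_progression_punctured {m n : ℤ} (hm : 0 < m) (hn : 0 < n) (S U : ℤ)
    (hU0 : 0 < U) (hU1 : U < n * m) :
    ({j : ℤ | 0 < S + m * j ∧ S + m * j < U}.ncard : ℤ)
      + ({j : ℤ | U - n * m < S + m * j ∧ S + m * j < 0}.ncard : ℤ) =
    n - (if ∃ j, S + m * j = 0 then 1 else 0) - (if ∃ j, S + m * j = U then 1 else 0) := by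
  obtain ⟨c, hc⟩ := exists_Ico_progression (n := n) hm S (U - n * m)
  set F := Finset.Ico c (c + n) with hF
  have e1 : {j : ℤ | 0 < S + m * j ∧ S + m * j < U} =
      ((F.filter fun j => 0 < S + m * j : Finset ℤ) : Set ℤ) := by
    ext j
    simp only [Set.mem_ofPred_eq, Finset.coe_filter, hc]
    constructor
    · rintro ⟨h, h'⟩
      exact ⟨⟨by linarith, by linarith⟩, h⟩
    · rintro ⟨⟨_, h'⟩, h⟩
      exact ⟨h, by linarith⟩
  have e2 : {j : ℤ | U - n * m < S + m * j ∧ S + m * j < 0} =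
      ((F.filter fun j => U - n * m < S + m * j ∧ S + m * j < 0 : Finset ℤ) : Set ℤ) := by
    ext j
    simp only [Set.mem_ofPred_eq, Finset.coe_filter, hc]
    constructor
    · rintro ⟨h, h'⟩
      exact ⟨⟨by linarith, by linarith⟩, h, h'⟩
    · exact fun h => h.2
  have z0 := card_filter_progression_eq hm S 0 F fun j hj => by
    rw [hc, hj]; constructor <;> linarith
  have z1 := card_filter_progression_eq hm S (U - n * m) F fun j hj => by
    rw [hc, hj]; constructor <;> linarith
  have hex : (∃ j, S + m * j = U - n * m) ↔ ∃ j, S + m * j = U :=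
    ⟨fun ⟨j, hj⟩ => ⟨j + n, by linear_combination hj⟩,
      fun ⟨j, hj⟩ => ⟨j - n, by linear_combination hj⟩⟩
  have hcard : (F.card : ℤ) = n := by
    rw [hF, Int.card_Ico, Int.toNat_of_nonneg] <;> linarith
  have hsum : F.card = (F.filter fun j => 0 < S + m * j).card
      + (F.filter fun j => U - n * m < S + m * j ∧ S + m * j < 0).card
      + (F.filter fun j => S + m * j = 0).card
      + (F.filter fun j => S + m * j = U - n * m).card := by
    simp only [Finset.card_filter]
    rw [Finset.card_eq_sum_ones, ← Finset.sum_add_distrib, ← Finset.sum_add_distrib,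
      ← Finset.sum_add_distrib]
    refine Finset.sum_congr rfl fun j hj => ?_
    rw [hc] at hj
    generalize S + m * j = w at *
    generalize n * m = N at *
    split_ifs <;> omega
  simp only [hex] at z1
  zify at hsum
  rw [← z0, ← z1, e1, e2, Set.ncard_coe_finset, Set.ncard_coe_finset]
  linarith

/-- The integer points of the line `a₂ x + a₁ y = k` through a given integer point. -/
theorem exists_eq_add_mul_of_line {a₁ a₂ x₀ y₀ x y : ℤ} (ha₁ : 0 < a₁) (hcop : IsCoprime a₁ a₂)
    (h : a₂ * x + a₁ * y = a₂ * x₀ + a₁ * y₀) : ∃ j, x = x₀ + a₁ * j ∧ y = y₀ - a₂ * j := by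
  have hdvd : a₁ ∣ x - x₀ :=
    hcop.dvd_of_dvd_mul_left ⟨y₀ - y, by linear_combination h⟩
  obtain ⟨j, hj⟩ := hdvd
  refine ⟨j, by linarith, mul_left_cancel₀ ha₁.ne' ?_⟩
  have hx : x = x₀ + a₁ * j := by linarith
  subst hx
  linear_combination h

theorem Mcount_eq_ncard_progression {a₁ a₂ n m₁ m₂ m : ℤ} (ha₁ : 0 < a₁)
    (hcop : IsCoprime a₁ a₂) (hn : 0 < n) (hm0 : 0 < m)
    (hm : m = m₁ * a₂ + m₂ * a₁ + n * (a₁ * a₂)) {θ : ℝ} {x₀ y₀ : ℤ}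
    (hk : ((a₂ * x₀ + a₁ * y₀ : ℤ) : ℝ) = m * θ) :
    Mcount (a₁ * n + m₁) m₂ m₁ (a₂ * n + m₂) θ =
      {j : ℤ | (0 < (a₂ * n + m₂) * x₀ - m₁ * y₀ + m * j ∧
        (a₂ * n + m₂) * x₀ - m₁ * y₀ + m * j < n * m) ∧
        n * (a₂ * x₀ + a₁ * y₀) - n * m < (a₂ * n + m₂) * x₀ - m₁ * y₀ + m * j ∧
        (a₂ * n + m₂) * x₀ - m₁ * y₀ + m * j < n * (a₂ * x₀ + a₁ * y₀)}.ncard := by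
  have hinj : Function.Injective fun j : ℤ => (x₀ + a₁ * j, y₀ - a₂ * j) := by
    intro i j hij
    have := (Prod.mk.inj hij).1
    exact mul_left_cancel₀ ha₁.ne' (by linarith)
  rw [← Set.ncard_image_of_injective _ hinj]
  unfold Mcount
  congr 1
  ext ⟨x, y⟩
  simp only [Set.mem_ofPred_eq, Set.mem_image, Prod.mk.injEq]
  rw [mem_para_and_uFun_eq_iff hn hm0 hm]
  have hS (j : ℤ) : (a₂ * n + m₂) * (x₀ + a₁ * j) - m₁ * (y₀ - a₂ * j) =
      (a₂ * n + m₂) * x₀ - m₁ * y₀ + m * j := by rw [hm]; ring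
  have hT (j : ℤ) : (a₁ * n + m₁) * (y₀ - a₂ * j) - m₂ * (x₀ + a₁ * j) =
      n * (a₂ * x₀ + a₁ * y₀) - ((a₂ * n + m₂) * x₀ - m₁ * y₀ + m * j) := by rw [hm]; ring
  constructor
  · rintro ⟨⟨⟨h1, h2⟩, h3, h4⟩, h5⟩
    rw [← hk, Int.cast_inj] at h5
    obtain ⟨j, rfl, rfl⟩ := exists_eq_add_mul_of_line ha₁ hcop h5
    rw [hS] at h1 h2
    rw [hT] at h3 h4
    exact ⟨j, ⟨⟨h1, h2⟩, by linarith, by linarith⟩, rfl, rfl⟩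
  · rintro ⟨j, ⟨⟨h1, h2⟩, h3, h4⟩, rfl, rfl⟩
    rw [hS, hT, ← hk]
    exact ⟨⟨⟨h1, h2⟩, by linarith, by linarith⟩, by congr 1; ring⟩

/-- The edge of the parallelogram in direction `(m₁, a₂ n + m₂)` meets the line
`a₂ x + a₁ y = k`, `0 < k < m`, in an integer point iff `m₁ = 0` and `a₁ ∣ k`. -/
theorem exists_progression_eq_zero_iff {a₁ a₂ n m₁ m₂ m x₀ y₀ : ℤ}
    (hcop : IsCoprime a₁ a₂) (hd : 0 < a₂ * n + m₂) (hm₁ : m₁ = 0 ∨ m₁ = 1)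
    (hm : m = m₁ * a₂ + m₂ * a₁ + n * (a₁ * a₂))
    (hk0 : 0 < a₂ * x₀ + a₁ * y₀) (hkm : a₂ * x₀ + a₁ * y₀ < m) :
    (∃ j, (a₂ * n + m₂) * x₀ - m₁ * y₀ + m * j = 0) ↔
      m₁ = 0 ∧ a₁ ∣ a₂ * x₀ + a₁ * y₀ := by
  constructor
  · rintro ⟨j, hj⟩
    rcases hm₁ with rfl | rfl
    · refine ⟨rfl, ?_⟩
      have hx : x₀ + a₁ * j = 0 := by
        apply mul_left_cancel₀ hd.ne'
        rw [hm] at hj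
        linear_combination hj
      exact ⟨y₀ - a₂ * j, by linear_combination a₂ * hx⟩
    · exfalso
      have e : a₂ * x₀ + a₁ * y₀ = m * (x₀ + a₁ * j) := by
        rw [hm] at hj ⊢
        linear_combination (-a₁) * hj
      have hm0 : 0 < m := by linarith
      rw [e] at hk0 hkm
      have h1 : 0 < x₀ + a₁ * j := pos_of_mul_pos_right hk0 hm0.le
      have h2 : x₀ + a₁ * j < 1 := by
        by_contra! h
        nlinarith
      omega
  · rintro ⟨rfl, h⟩
    have hdvd : a₁ ∣ x₀ :=
      hcop.dvd_of_dvd_mul_left ((Int.dvd_add_left (dvd_mul_right a₁ y₀)).1 h)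
    obtain ⟨i, rfl⟩ := hdvd
    exact ⟨-i, by rw [hm]; ring⟩

theorem exists_intCast_eq_div_iff_dvd {a k : ℤ} (ha : 0 < a) :
    (∃ j : ℤ, (j : ℝ) = (k : ℝ) / a) ↔ a ∣ k := by
  have haR : (a : ℝ) ≠ 0 := by exact_mod_cast ha.ne'
  constructor
  · rintro ⟨j, hj⟩
    rw [eq_div_iff haR] at hj
    exact ⟨j, by rw [mul_comm]; exact_mod_cast hj.symm⟩
  · rintro ⟨j, rfl⟩
    exact ⟨j, by rw [eq_div_iff haR]; push_cast; ring⟩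

theorem Mcount_eq_zero_of_not_int {a₁ a₂ n m₁ m₂ m : ℤ} (hn : 0 < n) (hm0 : 0 < m)
    (hm : m = m₁ * a₂ + m₂ * a₁ + n * (a₁ * a₂)) {θ : ℝ}
    (hθ : ¬ ∃ j : ℤ, (j : ℝ) = (m : ℝ) * θ) :
    Mcount (a₁ * n + m₁) m₂ m₁ (a₂ * n + m₂) θ = 0 := by
  unfold Mcount
  convert Set.ncard_empty (ℤ × ℤ)
  refine Set.eq_empty_of_forall_notMem fun ⟨x, y⟩ h => ?_
  exact hθ ⟨_, ((mem_para_and_uFun_eq_iff hn hm0 hm θ x y).1 h).2⟩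

theorem M_plus_add_M_minus_eq_root_multiplicity
    (a₁ a₂ n m₁ m₂ m : ℤ)
    (ha₁ : 0 < a₁) (ha₂ : 0 < a₂) (hcop : IsCoprime a₁ a₂) (hn : 0 < n)
    (hm₁ : m₁ = 0 ∨ m₁ = 1) (hm₂ : m₂ = 0 ∨ m₂ = 1)
    (hm : m = m₁ * a₂ + m₂ * a₁ + n * (a₁ * a₂))
    (θ : ℝ) (h0 : 0 < θ) (h1 : θ < 1) :
    (Mcount (a₁ * n + m₁) m₂ m₁ (a₂ * n + m₂) θ : ℤ)
      + (Mcount (a₁ * n + m₁) m₂ m₁ (a₂ * n + m₂) (θ + 1) : ℤ) =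
      n * (if ∃ j : ℤ, (j : ℝ) = (m : ℝ) * θ then 1 else 0)
      - (1 - m₁) * (if ∃ j : ℤ, (j : ℝ) = (m : ℝ) * θ / (a₁ : ℝ) then 1 else 0)
      - (1 - m₂) * (if ∃ j : ℤ, (j : ℝ) = (m : ℝ) * θ / (a₂ : ℝ) then 1 else 0) := by
  have hm₁0 : 0 ≤ m₁ := by omega
  have hm₂0 : 0 ≤ m₂ := by omega
  have hm0 : 0 < m := by rw [hm]; positivity
  have hmR : (0 : ℝ) < m := by exact_mod_cast hm0
  by_cases hint : ∃ j : ℤ, (j : ℝ) = (m : ℝ) * θ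
  · rw [if_pos hint]
    obtain ⟨k, hk⟩ := hint
    have hk0 : 0 < k := by
      have : (0 : ℝ) < k := by rw [hk]; positivity
      exact_mod_cast this
    have hkm : k < m := by
      have : (k : ℝ) < m := by rw [hk]; exact mul_lt_of_lt_one_right hmR h1
      exact_mod_cast this
    rw [← hk]
    simp only [exists_intCast_eq_div_iff_dvd ha₁, exists_intCast_eq_div_iff_dvd ha₂]
    obtain ⟨p, q, hpq⟩ := hcop
    obtain ⟨x₀, y₀, rfl⟩ : ∃ x₀ y₀, k = a₂ * x₀ + a₁ * y₀ :=
      ⟨q * k, p * k, by linear_combination (-k) * hpq⟩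
    have hcop : IsCoprime a₁ a₂ := ⟨p, q, hpq⟩
    set S := (a₂ * n + m₂) * x₀ - m₁ * y₀ with hS
    set k := a₂ * x₀ + a₁ * y₀ with hkdef
    have hnk : n * k < n * m := mul_lt_mul_of_pos_left hkm hn
    have hnk0 : 0 < n * k := mul_pos hn hk0
    have hplus : Mcount (a₁ * n + m₁) m₂ m₁ (a₂ * n + m₂) θ =
        {j : ℤ | 0 < S + m * j ∧ S + m * j < n * k}.ncard := by
      rw [Mcount_eq_ncard_progression ha₁ hcop hn hm0 hm hk]
      congr 1
      ext j
      simp only [Set.mem_ofPred_eq, ← hS, ← hkdef]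
      constructor
      · rintro ⟨⟨h, _⟩, _, h'⟩
        exact ⟨h, h'⟩
      · rintro ⟨h, h'⟩
        exact ⟨⟨h, by linarith⟩, by linarith, h'⟩
    have hshift : a₂ * (x₀ + (a₁ * n + m₁)) + a₁ * (y₀ + m₂) = k + m := by
      rw [hkdef, hm]; ring
    have hSshift : (a₂ * n + m₂) * (x₀ + (a₁ * n + m₁)) - m₁ * (y₀ + m₂) = S + n * m := by
      rw [hS, hm]; ring
    have hminus : Mcount (a₁ * n + m₁) m₂ m₁ (a₂ * n + m₂) (θ + 1) =
        {j : ℤ | n * k - n * m < S + m * j ∧ S + m * j < 0}.ncard := by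
      rw [Mcount_eq_ncard_progression ha₁ hcop hn hm0 hm
        (x₀ := x₀ + (a₁ * n + m₁)) (y₀ := y₀ + m₂)
        (by rw [hshift, mul_add, ← hk]; push_cast; ring)]
      congr 1
      ext j
      simp only [Set.mem_ofPred_eq]
      rw [hshift, hSshift, mul_add]
      constructor
      · rintro ⟨⟨h, h'⟩, h'', _⟩
        exact ⟨by linarith, by linarith⟩
      · rintro ⟨h, h'⟩
        exact ⟨⟨by linarith, by linarith⟩, by linarith, by linarith⟩
    rw [hplus, hminus, card_progression_punctured hm0 hn S (n * k) hnk0 hnk]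
    have E1 := exists_progression_eq_zero_iff (x₀ := x₀) (y₀ := y₀) hcop
      (show 0 < a₂ * n + m₂ by positivity) hm₁ hm hk0 hkm
    have E2 := exists_progression_eq_zero_iff (m₂ := m₁) (m := m) (x₀ := y₀) (y₀ := x₀)
      hcop.symm (show 0 < a₁ * n + m₁ by positivity) hm₂ (by rw [hm]; ring)
      (by linarith) (by linarith)
    have hswap : (∃ j, S + m * j = n * k) ↔
        ∃ j, (a₁ * n + m₁) * y₀ - m₂ * x₀ + m * j = 0 := by
      constructor
      · rintro ⟨j, hj⟩
        exact ⟨-j, by rw [hS, hkdef] at hj; linear_combination -hj⟩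
      · rintro ⟨j, hj⟩
        exact ⟨-j, by rw [hS, hkdef]; linear_combination -hj⟩
    rw [add_comm (a₁ * y₀), ← hkdef] at E2
    rw [← hS, ← hkdef] at E1
    simp only [hswap, E2, E1]
    clear_value k
    rcases hm₁ with rfl | rfl <;> rcases hm₂ with rfl | rfl <;> simp
  · have hint' : ¬ ∃ j : ℤ, (j : ℝ) = (m : ℝ) * (θ + 1) := by
      rintro ⟨j, hj⟩
      exact hint ⟨j - m, by push_cast; linear_combination hj⟩
    have hdiv {a : ℤ} (ha : 0 < a) : ¬ ∃ j : ℤ, (j : ℝ) = (m : ℝ) * θ / (a : ℝ) := by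
      rintro ⟨j, hj⟩
      rw [eq_div_iff (by exact_mod_cast ha.ne')] at hj
      exact hint ⟨j * a, by exact_mod_cast hj⟩
    rw [Mcount_eq_zero_of_not_int hn hm0 hm hint, Mcount_eq_zero_of_not_int hn hm0 hm hint',
      if_neg hint, if_neg (hdiv ha₁), if_neg (hdiv ha₂)]
    simp
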